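/- arXiv:2104.00522 — 9 statements merged into one kernel-verified Lean document; each statement's English description precedes it below -/
import Mathlib

section
/- The sequence (ρ_n)_{n≥1} is the unique convergent real sequence satisfying the recurrence r_n + r_{n+1} = 1/(2n+1) for all n ≥ 1: if (r_n)_{n≥1} is a real sequence with r_n + r_{n+1} = 1/(2n+1) for all n ≥ 1 and (r_n) converges, then r_n = ρ_n for all n ≥ 1. -/
open Filter

/-- `(ρ_n)` is the unique convergent sequence satisfying `r_n + r_{n+1} = 1/(2n+1)`
for all `n ≥ 1`: any convergent sequence with this recurrence coincides with `ρ`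
on `n ≥ 1`. -/
theorem madhava_leibniz_remainder_unique
    (S : ℕ → ℝ) (hS : ∀ n, S n = ∑ p ∈ Finset.Icc 1 n, (-1 : ℝ) ^ (p - 1) / (2 * (p : ℝ) - 1))
    (ρ : ℕ → ℝ) (hρ : ∀ n, ρ n = (-1 : ℝ) ^ n * (Real.pi / 4 - S n))
    (r : ℕ → ℝ) (hr : ∀ n : ℕ, 1 ≤ n → r n + r (n + 1) = 1 / (2 * (n : ℝ) + 1))
    (hconv : ∃ L : ℝ, Tendsto r atTop (nhds L)) :
    ∀ n : ℕ, 1 ≤ n → r n = ρ n := by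
  obtain ⟨L, hL⟩ := hconv
  have hS' : ∀ n, S n = ∑ i ∈ Finset.range n, (-1 : ℝ) ^ i / (2 * (i : ℝ) + 1) := by
    intro n
    rw [hS]
    induction n with
    | zero => simp
    | succ k ih =>
      rw [Finset.sum_Icc_succ_top (by omega), ih, Finset.sum_range_succ]
      congr 1
      push_cast
      congr 1
      ring
  have hSlim : Tendsto S atTop (nhds (Real.pi / 4)) := by
    rw [funext hS']
    exact Real.tendsto_sum_pi_div_four
  have hL0 : L = 0 := by
    have h1 : Tendsto (fun n => r n + r (n + 1)) atTop (nhds (L + L)) :=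
      hL.add (hL.comp (tendsto_add_atTop_nat 1))
    have h2 : Tendsto (fun n : ℕ => 1 / (2 * (n : ℝ) + 1)) atTop (nhds 0) := by
      have h3 : Tendsto (fun n : ℕ => 2 * (n : ℝ) + 1) atTop atTop :=
        tendsto_atTop_add_const_right _ _
          (tendsto_natCast_atTop_atTop.const_mul_atTop (by norm_num))
      exact h3.const_div_atTop 1
    have h4 : Tendsto (fun n => r n + r (n + 1)) atTop (nhds 0) := by
      refine h2.congr' ?_
      filter_upwards [eventually_ge_atTop 1] with n hn
      exact (hr n hn).symm
    have := tendsto_nhds_unique h1 h4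
    linarith
  subst hL0
  have hz : Tendsto (fun n => (-1 : ℝ) ^ n * r n) atTop (nhds 0) := by
    rw [tendsto_zero_iff_abs_tendsto_zero] at hL ⊢
    refine hL.congr ?_
    intro n
    simp [abs_mul]
  have hlim : Tendsto (fun n => (-1 : ℝ) ^ n * r n + S n) atTop (nhds (Real.pi / 4)) := by
    simpa using hz.add hSlim
  have hstep : ∀ n : ℕ, 1 ≤ n →
      (-1 : ℝ) ^ (n + 1) * r (n + 1) + S (n + 1) = (-1 : ℝ) ^ n * r n + S n := by
    intro n hn
    have h1 : r (n + 1) = 1 / (2 * (n : ℝ) + 1) - r n := by linarith [hr n hn]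
    rw [h1, hS' (n + 1), Finset.sum_range_succ, ← hS' n]
    ring
  intro n hn
  have hconst : ∀ m : ℕ, n ≤ m →
      (-1 : ℝ) ^ m * r m + S m = (-1 : ℝ) ^ n * r n + S n := by
    intro m hm
    induction m, hm using Nat.le_induction with
    | base => rfl
    | succ m hm ih => rw [hstep m (by omega), ih]
  have hlim2 : Tendsto (fun m => (-1 : ℝ) ^ m * r m + S m) atTop
      (nhds ((-1 : ℝ) ^ n * r n + S n)) := by
    refine tendsto_const_nhds.congr' ?_
    filter_upwards [eventually_ge_atTop n] with m hm
    exact (hconst m hm).symm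
  have heq := tendsto_nhds_unique hlim hlim2
  have hsq : (-1 : ℝ) ^ n * (-1 : ℝ) ^ n = 1 := by
    rw [← mul_pow]
    simp
  rw [hρ, heq]
  linear_combination (-(r n)) * hsq
end

section
/- (Proposition 1) For every integer n ≥ 1, the remainder ρ_n of the Mādhava–Leibniz series equals the value of the generalized continued fraction (1/2)/(2n + 1²/(2n + 2²/(2n + 3²/(2n + ···)))); precisely, the sequence of convergents of the generalized continued fraction with partial numerators a_0 = 1/2 and a_k = k² for k ≥ 1, and all partial denominators equal to 2n, converges to ρ_n. Equivalently, π = 4∑_{p=1}^{n} (-1)^{p-1}/(2p-1) + (-1)^n · 2/(2n + 1²/(2n + 2²/(2n + ···))). -/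
open Filter

/-- `gcfAux a b j m` is the finite continued fraction
`a j / (b j + a (j+1) / (b (j+1) + ⋯ + a (j+m) / b (j+m)))`. -/
noncomputable def gcfAux (a b : ℕ → ℝ) : ℕ → ℕ → ℝ
  | j, 0 => a j / b j
  | j, m + 1 => a j / (b j + gcfAux a b (j + 1) m)

/-- The `k`-th convergent of the generalized continued fraction
`a₀/(b₀ + a₁/(b₁ + a₂/(b₂ + ⋯)))` (so the `0`-th convergent is `a₀/b₀`). -/
noncomputable def gcfConvergent (a b : ℕ → ℝ) (k : ℕ) : ℝ := gcfAux a b 0 k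

/-- Continuants: solutions of `y (k+2) = x y (k+1) + (k+1)² y k`. -/
noncomputable def mlCont (x u v : ℝ) : ℕ → ℝ
  | 0 => u
  | 1 => v
  | k + 2 => x * mlCont x u v (k + 1) + ((k : ℝ) + 1) ^ 2 * mlCont x u v k

/-- The integrand. -/
noncomputable def mlF (n k : ℕ) (t : ℝ) : ℝ :=
  2 * t ^ (2 * n) / (1 + t ^ 2) * ((1 - t ^ 2) / (1 + t ^ 2)) ^ k

/-- The integrals giving the minimal solution of the recurrence. -/
noncomputable def mlI (n k : ℕ) : ℝ := ∫ t in (0 : ℝ)..1, mlF n k t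

lemma mlF_cont (n k : ℕ) : Continuous (mlF n k) := by
  unfold mlF
  have h : ∀ t : ℝ, 1 + t ^ 2 ≠ 0 := fun t => by positivity
  fun_prop (disch := exact h _)

lemma mlF_int (n k : ℕ) : IntervalIntegrable (mlF n k) MeasureTheory.volume 0 1 :=
  (mlF_cont n k).intervalIntegrable _ _

lemma mlI_nonneg (n k : ℕ) : 0 ≤ mlI n k := by
  unfold mlI
  apply intervalIntegral.integral_nonneg (by norm_num)
  intro t ht
  have h1 : 0 ≤ 1 - t ^ 2 := by nlinarith [ht.1, ht.2]
  have h0 := ht.1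
  unfold mlF
  positivity

lemma ml_w_deriv (t : ℝ) :
    HasDerivAt (fun t : ℝ => (1 - t ^ 2) / (1 + t ^ 2)) (-4 * t / (1 + t ^ 2) ^ 2) t := by
  have h : 1 + t ^ 2 ≠ 0 := by positivity
  have h2 : HasDerivAt (fun t : ℝ => t ^ 2) (2 * t) t := by simpa using hasDerivAt_pow 2 t
  have := (h2.const_sub 1).fun_div (h2.const_add 1) h
  refine this.congr_deriv ?_
  field_simp
  ring

lemma ml_g_deriv (n : ℕ) (t : ℝ) :
    HasDerivAt (fun t : ℝ => 2 * t ^ (2 * n + 1) / (1 + t ^ 2))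
      (2 * n * (2 * t ^ (2 * n) / (1 + t ^ 2))
        + (2 * t ^ (2 * n) / (1 + t ^ 2)) * ((1 - t ^ 2) / (1 + t ^ 2))) t := by
  have h : 1 + t ^ 2 ≠ 0 := by positivity
  have h2 : HasDerivAt (fun t : ℝ => t ^ 2) (2 * t) t := by simpa using hasDerivAt_pow 2 t
  have h3 : HasDerivAt (fun t : ℝ => t ^ (2 * n + 1)) ((2 * n + 1) * t ^ (2 * n)) t := by
    simpa using hasDerivAt_pow (2 * n + 1) t
  have := (h3.const_mul 2).fun_div (h2.const_add 1) h
  refine this.congr_deriv ?_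
  field_simp
  ring

lemma mlI_zero_rec (n : ℕ) : 2 * n * mlI n 0 + mlI n 1 = 1 := by
  have := intervalIntegral.integral_eq_sub_of_hasDerivAt
    (f := fun t : ℝ => 2 * t ^ (2 * n + 1) / (1 + t ^ 2))
    (f' := fun t => 2 * n * mlF n 0 t + mlF n 1 t) (a := 0) (b := 1)
    (fun t _ => by
      refine (ml_g_deriv n t).congr_deriv ?_
      simp [mlF])
    (((mlF_int n 0).const_mul _).add (mlF_int n 1))
  rw [intervalIntegral.integral_add ((mlF_int n 0).const_mul _) (mlF_int n 1),
    intervalIntegral.integral_const_mul] at this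
  unfold mlI
  rw [this]
  norm_num

lemma mlI_succ_rec (n k : ℕ) :
    2 * n * mlI n (k + 1) + (k + 2) * mlI n (k + 2) = (k + 1) * mlI n k := by
  have i1 := (mlF_int n (k + 1)).const_mul (2 * n : ℝ)
  have i2 := (mlF_int n (k + 2)).const_mul (k + 2 : ℝ)
  have i3 := (mlF_int n k).const_mul (k + 1 : ℝ)
  have := intervalIntegral.integral_eq_sub_of_hasDerivAt
    (f := fun t : ℝ => 2 * t ^ (2 * n + 1) / (1 + t ^ 2) * ((1 - t ^ 2) / (1 + t ^ 2)) ^ (k + 1))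
    (f' := fun t => 2 * n * mlF n (k + 1) t + (k + 2) * mlF n (k + 2) t - (k + 1) * mlF n k t)
    (a := 0) (b := 1)
    (fun t _ => by
      have hh := (ml_g_deriv n t).fun_mul ((ml_w_deriv t).fun_pow (k + 1))
      refine hh.congr_deriv ?_
      have h : 1 + t ^ 2 ≠ 0 := by positivity
      have e : -4 * t / (1 + t ^ 2) ^ 2 * t = (((1 - t ^ 2) / (1 + t ^ 2)) ^ 2 - 1) := by
        field_simp
        ring
      have e2 : 2 * t ^ (2 * n + 1) / (1 + t ^ 2) = 2 * t ^ (2 * n) / (1 + t ^ 2) * t := by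
        ring
      rw [e2]
      simp only [mlF, Nat.add_sub_cancel]
      push_cast
      generalize (1 - t ^ 2) / (1 + t ^ 2) = w at *
      generalize 2 * t ^ (2 * n) / (1 + t ^ 2) = g at *
      generalize -4 * t / (1 + t ^ 2) ^ 2 = d at *
      linear_combination (g * (k + 1) * w ^ k) * e)
    ((i1.add i2).sub i3)
  rw [intervalIntegral.integral_sub (i1.add i2) i3, intervalIntegral.integral_add i1 i2,
    intervalIntegral.integral_const_mul, intervalIntegral.integral_const_mul,
    intervalIntegral.integral_const_mul] at this
  norm_num at this
  unfold mlI
  linarith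

lemma mlI_step (n : ℕ) : mlI n 0 + mlI (n + 1) 0 = 2 / (2 * n + 1) := by
  unfold mlI
  rw [← intervalIntegral.integral_add (mlF_int _ _) (mlF_int _ _)]
  have : ∀ t : ℝ, mlF n 0 t + mlF (n + 1) 0 t = 2 * t ^ (2 * n) := by
    intro t
    have h : 1 + t ^ 2 ≠ 0 := by positivity
    simp only [mlF, pow_zero, mul_one]
    field_simp
    ring
  simp only [this]
  rw [intervalIntegral.integral_const_mul, integral_pow]
  simp
  ring

lemma mlI_base : mlI 0 0 = Real.pi / 2 := by
  unfold mlI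
  have : ∀ t : ℝ, mlF 0 0 t = 2 * (1 / (1 + t ^ 2)) := by
    intro t
    simp only [mlF]
    ring
  simp only [this]
  rw [intervalIntegral.integral_const_mul, integral_one_div_one_add_sq]
  simp
  ring

lemma mlI_eq (n : ℕ) : mlI n 0 = 2 * ((-1 : ℝ) ^ n *
    (Real.pi / 4 - ∑ p ∈ Finset.Icc 1 n, (-1 : ℝ) ^ (p - 1) / (2 * (p : ℝ) - 1))) := by
  induction n with
  | zero => rw [mlI_base]; simp; ring
  | succ n ih =>
    have h := mlI_step n
    rw [Finset.sum_Icc_succ_top (by omega)]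
    have e : (-1 : ℝ) ^ n * (-1 : ℝ) ^ n = 1 := by
      rw [← mul_pow]; simp
    have h1 : mlI (n + 1) 0 = 2 / (2 * n + 1) - mlI n 0 := by linarith
    rw [h1, ih]
    simp only [Nat.add_sub_cancel]
    push_cast
    have e3 : (2 * ((n : ℝ) + 1) - 1) = 2 * n + 1 := by ring
    rw [e3, pow_succ]
    linear_combination (-(2 / (2 * (n : ℝ) + 1))) * e

lemma mlI_bound (n : ℕ) (hn : 1 ≤ n) (k : ℕ) :
    (k + 1) * (mlI n (k + 1) + mlI n k) ≤ mlI n 1 + mlI n 0 := by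
  have hn' : (1 : ℝ) ≤ n := by exact_mod_cast hn
  induction k with
  | zero => simp
  | succ k ih =>
    have h := mlI_succ_rec n k
    have h1 := mlI_nonneg n (k + 1)
    push_cast
    nlinarith

lemma mlI_tendsto (n : ℕ) (hn : 1 ≤ n) : Tendsto (mlI n) atTop (nhds 0) := by
  have h := tendsto_one_div_add_atTop_nhds_zero_nat (𝕜 := ℝ)
  have h2 := h.const_mul (mlI n 1 + mlI n 0)
  rw [mul_zero] at h2
  refine squeeze_zero (mlI_nonneg n) (fun k => ?_) h2
  rw [mul_one_div, le_div_iff₀ (by positivity)]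
  have := mlI_bound n hn k
  have h1 := mlI_nonneg n (k + 1)
  have : 0 ≤ ((k : ℝ) + 1) * mlI n (k + 1) := by positivity
  linarith

lemma mlCont_lower (x : ℝ) (hx : 1 ≤ x) (k : ℕ) :
    (k.factorial : ℝ) ≤ mlCont x 1 x k ∧ ((k + 1).factorial : ℝ) ≤ mlCont x 1 x (k + 1) := by
  induction k with
  | zero => simp [mlCont, hx]
  | succ k ih =>
    refine ⟨ih.2, ?_⟩
    rw [mlCont]
    have h1 := ih.1
    have h2 := ih.2
    rw [Nat.factorial_succ (k + 1)]
    have e : ((k + 1).factorial : ℝ) = (k + 1) * k.factorial := by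
      rw [Nat.factorial_succ]; push_cast; ring
    have p : (0 : ℝ) < (k + 1).factorial := by positivity
    push_cast
    have h3 : ((k : ℝ) + 1) ^ 2 * k.factorial ≤ ((k : ℝ) + 1) ^ 2 * mlCont x 1 x k := by gcongr
    have h4 : 1 * ((k + 1).factorial : ℝ) ≤ x * mlCont x 1 x (k + 1) := by gcongr
    have h5 : ((k : ℝ) + 1) ^ 2 * k.factorial = (k + 1) * ((k + 1).factorial : ℝ) := by
      rw [e]; ring
    linarith

lemma mlCont_err (n k : ℕ) :
    mlCont (2 * n) 1 (2 * n) k * mlI n 0 - mlCont (2 * n) 0 1 k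
      = (-1) ^ k * k.factorial * mlI n k ∧
    mlCont (2 * n) 1 (2 * n) (k + 1) * mlI n 0 - mlCont (2 * n) 0 1 (k + 1)
      = (-1) ^ (k + 1) * (k + 1).factorial * mlI n (k + 1) := by
  induction k with
  | zero =>
    have := mlI_zero_rec n
    simp [mlCont]
    linarith
  | succ k ih =>
    refine ⟨ih.2, ?_⟩
    obtain ⟨h1, h2⟩ := ih
    have h := mlI_succ_rec n k
    rw [mlCont, mlCont]
    rw [Nat.factorial_succ (k + 1)]
    rw [Nat.factorial_succ] at h2 ⊢
    push_cast at h2 ⊢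
    linear_combination (2 * n : ℝ) * h2 + ((k : ℝ) + 1) ^ 2 * h1
      - (-1) ^ k * ((k : ℝ) + 1) * k.factorial * h

lemma ml_gcf_nonneg (c x : ℝ) (hx : 1 ≤ x) (m j : ℕ) :
    0 ≤ gcfAux (fun j => if j = 0 then c else (j : ℝ) ^ 2) (fun _ => x) (j + 1) m := by
  induction m generalizing j with
  | zero => simp [gcfAux]; positivity
  | succ m ih =>
    have := ih (j + 1)
    rw [gcfAux]
    simp only [Nat.add_eq_zero_iff, one_ne_zero, and_false, if_false]
    positivity

lemma ml_gcf_aux (c x : ℝ) (hx : 1 ≤ x) (m j : ℕ) (f : ℝ)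
    (hf : f = gcfAux (fun j => if j = 0 then c else (j : ℝ) ^ 2) (fun _ => x) (j + 1) m) :
    (mlCont x 0 1 (j + 1) + f * mlCont x 0 1 j) * mlCont x 1 x (j + m + 2)
     = mlCont x 0 1 (j + m + 2) * (mlCont x 1 x (j + 1) + f * mlCont x 1 x j) := by
  have hx0 : x ≠ 0 := by positivity
  induction m generalizing j f with
  | zero =>
    simp [gcfAux] at hf
    subst hf
    simp only [add_zero, mlCont]
    field_simp
  | succ m ih =>
    have h := ih (j + 1) _ rfl
    have hp := ml_gcf_nonneg c x hx m (j + 1)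
    rw [gcfAux] at hf
    simp only [Nat.add_eq_zero_iff, one_ne_zero, and_false, if_false] at hf
    generalize gcfAux (fun j => if j = 0 then c else (j : ℝ) ^ 2) (fun _ => x) (j + 1 + 1) m = g at *
    have hg : x + g ≠ 0 := by positivity
    have e : j + 1 + m + 2 = j + (m + 1) + 2 := by ring
    rw [e] at h
    generalize mlCont x 1 x (j + (m + 1) + 2) = B at *
    generalize mlCont x 0 1 (j + (m + 1) + 2) = A at *
    simp only [mlCont] at h
    subst hf
    push_cast
    field_simp
    linear_combination h

lemma ml_gcf_eq (c x : ℝ) (hx : 1 ≤ x) (k : ℕ) :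
    gcfConvergent (fun j => if j = 0 then c else (j : ℝ) ^ 2) (fun _ => x) (k + 1)
      = c * (mlCont x 0 1 (k + 2) / mlCont x 1 x (k + 2)) := by
  have h := ml_gcf_aux c x hx k 0 _ rfl
  have hp := ml_gcf_nonneg c x hx k 0
  have hB : mlCont x 1 x (k + 2) ≠ 0 := by
    have := (mlCont_lower x hx (k + 2)).1
    have p : (0 : ℝ) < (k + 2).factorial := by positivity
    linarith
  rw [gcfConvergent, gcfAux]
  generalize gcfAux (fun j => if j = 0 then c else (j : ℝ) ^ 2) (fun _ => x) (0 + 1) k = g at *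
  have hg : x + g ≠ 0 := by positivity
  simp only [zero_add] at h
  generalize mlCont x 1 x (k + 2) = B at *
  generalize mlCont x 0 1 (k + 2) = A at *
  simp only [mlCont] at h
  simp only [if_true]
  field_simp
  linear_combination c * h

lemma ml_gcf_tendsto (c : ℝ) (n : ℕ) (hn : 1 ≤ n) :
    Tendsto (fun k => gcfConvergent (fun j => if j = 0 then c else (j : ℝ) ^ 2)
      (fun _ => (2 * n : ℝ)) k) atTop (nhds (c * mlI n 0)) := by
  have hn' : (1 : ℝ) ≤ n := by exact_mod_cast hn
  have hx : (1 : ℝ) ≤ 2 * n := by linarith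
  rw [← tendsto_add_atTop_iff_nat 1]
  simp only [ml_gcf_eq c _ hx]
  apply Tendsto.const_mul
  have key : Tendsto (fun k => mlCont (2 * n) 0 1 k / mlCont (2 * n) 1 (2 * n) k) atTop
      (nhds (mlI n 0)) := by
    rw [tendsto_iff_dist_tendsto_zero]
    refine squeeze_zero (fun _ => dist_nonneg) (fun k => ?_) (mlI_tendsto n hn)
    have hl := (mlCont_lower _ hx k).1
    have p : (0 : ℝ) < k.factorial := by positivity
    have he := (mlCont_err n k).1
    have hI := mlI_nonneg n k
    have hB : 0 < mlCont (2 * n) 1 (2 * n) k := by linarith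
    rw [dist_comm, Real.dist_eq]
    have : mlI n 0 - mlCont (2 * n) 0 1 k / mlCont (2 * n) 1 (2 * n) k
        = ((-1) ^ k * k.factorial * mlI n k) / mlCont (2 * n) 1 (2 * n) k := by
      rw [← he]
      field_simp
    rw [this, abs_div, abs_mul, abs_mul, abs_pow, abs_neg, abs_one, one_pow, one_mul,
      abs_of_pos p, abs_of_pos hB, abs_of_nonneg hI, div_le_iff₀ hB, mul_comm]
    gcongr
  exact key.comp (tendsto_add_atTop_nat 2)

/-- Proposition 1: for every `n ≥ 1`, the remainder `ρ_n = (-1)^n (π/4 - S_n)` of the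
Mādhava–Leibniz series is the value of the generalized continued fraction
`(1/2)/(2n + 1²/(2n + 2²/(2n + 3²/(2n + ⋯))))`; equivalently
`π = 4 S_n + (-1)^n ⬝ 2/(2n + 1²/(2n + 2²/(2n + ⋯)))`. -/
theorem madhava_leibniz_remainder_gcf
    (S : ℕ → ℝ) (hS : ∀ n, S n = ∑ p ∈ Finset.Icc 1 n, (-1 : ℝ) ^ (p - 1) / (2 * (p : ℝ) - 1))
    (ρ : ℕ → ℝ) (hρ : ∀ n, ρ n = (-1 : ℝ) ^ n * (Real.pi / 4 - S n)) :
    ∀ n : ℕ, 1 ≤ n →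
      Tendsto
        (fun k => gcfConvergent
          (fun j => if j = 0 then (1 / 2 : ℝ) else (j : ℝ) ^ 2)
          (fun _ => (2 * n : ℝ)) k)
        atTop (nhds (ρ n)) ∧
      Tendsto
        (fun k => 4 * S n + (-1 : ℝ) ^ n *
          gcfConvergent
            (fun j => if j = 0 then (2 : ℝ) else (j : ℝ) ^ 2)
            (fun _ => (2 * n : ℝ)) k)
        atTop (nhds Real.pi) := by
  intro n hn
  have h0 := mlI_eq n
  rw [← hS, ← hρ] at h0
  constructor
  · convert ml_gcf_tendsto (1 / 2) n hn using 2
    rw [h0]; ring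
  · have h := ((ml_gcf_tendsto 2 n hn).const_mul ((-1 : ℝ) ^ n)).const_add (4 * S n)
    convert h using 2
    have e : (-1 : ℝ) ^ n * (-1 : ℝ) ^ n = 1 := by
      rw [← mul_pow]; simp
    rw [h0, hρ]
    linear_combination (-(4 * (Real.pi / 4 - S n))) * e
end

section
/- (Proposition 2 (iii), exact error identity) Let (u_p)_{p≥1} be a real sequence such that ∑_{p≥1} (-1)^{p-1} u_p converges to φ, with partial sums S_n and ρ_n = (-1)^n(φ - S_n), assumed nonzero for all n. Let (R_n)_{n≥1} satisfy R_n = (1 + ε_n) ρ_n for all n ≥ 1, where ε_n → 0, and define S''_n = u_1 - R_1 + ∑_{p=1}^{n} (-1)^{p-1} [(R_p + R_{p+1}) - u_{p+1}]. Then for every n ≥ 1, |S''_n - φ| = |ε_{n+1}| · |S_{n+1} - φ|; in particular (S''_n) converges to φ faster than (S_{n+1}), i.e. (φ - S''_n)/(φ - S_{n+1}) → 0. -/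
open Filter

/-- Proposition 2 (iii): if `R_n = (1 + ε_n) ρ_n` with `ε_n → 0`, then the transformed
sums `S''_n = u₁ - R₁ + ∑_{p=1}^n (-1)^(p-1) ((R_p + R_{p+1}) - u_{p+1})` satisfy the
exact error identity `|S''_n - φ| = |ε_{n+1}| ⬝ |S_{n+1} - φ|` for every `n ≥ 1`;
in particular `(S''_n)` converges to `φ` faster than `(S_{n+1})`. -/
theorem transformed_sums_error_identity
    (u : ℕ → ℝ) (φ : ℝ)
    (S : ℕ → ℝ) (hS : ∀ n, S n = ∑ p ∈ Finset.Icc 1 n, (-1 : ℝ) ^ (p - 1) * u p)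
    (hSφ : Tendsto S atTop (nhds φ))
    (ρ : ℕ → ℝ) (hρ : ∀ n, ρ n = (-1 : ℝ) ^ n * (φ - S n))
    (hρ0 : ∀ n : ℕ, 1 ≤ n → ρ n ≠ 0)
    (R ε : ℕ → ℝ) (hε : Tendsto ε atTop (nhds 0))
    (hRε : ∀ n : ℕ, 1 ≤ n → R n = (1 + ε n) * ρ n)
    (S'' : ℕ → ℝ)
    (hS'' : ∀ n, S'' n = u 1 - R 1 +
      ∑ p ∈ Finset.Icc 1 n, (-1 : ℝ) ^ (p - 1) * ((R p + R (p + 1)) - u (p + 1))) :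
    (∀ n : ℕ, 1 ≤ n → |S'' n - φ| = |ε (n + 1)| * |S (n + 1) - φ|) ∧
      Tendsto (fun n => (φ - S'' n) / (φ - S (n + 1))) atTop (nhds 0) := by
  have key : ∀ n, S'' n = S (n + 1) + (-1 : ℝ) ^ (n + 1) * R (n + 1) := by
    intro n
    induction n with
    | zero =>
      rw [hS'', hS]
      simp
      ring
    | succ k ih =>
      have h1 : S'' (k + 1) = S'' k +
          (-1 : ℝ) ^ k * ((R (k + 1) + R (k + 1 + 1)) - u (k + 1 + 1)) := by
        rw [hS'', hS'', Finset.sum_Icc_succ_top (by omega), Nat.add_sub_cancel]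
        ring
      have h2 : S (k + 1 + 1) = S (k + 1) + (-1 : ℝ) ^ (k + 1) * u (k + 1 + 1) := by
        rw [hS (k + 1 + 1), hS (k + 1), Finset.sum_Icc_succ_top (by omega), Nat.add_sub_cancel]
      rw [h1, h2, ih]
      ring
  have err : ∀ n, S'' n - φ = ε (n + 1) * (φ - S (n + 1)) := by
    intro n
    rw [key, hRε (n + 1) (by omega), hρ]
    have h : (-1 : ℝ) ^ (n + 1) * (-1 : ℝ) ^ (n + 1) = 1 := by
      rw [← mul_pow]
      simp
    linear_combination (1 + ε (n + 1)) * (φ - S (n + 1)) * h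
  refine ⟨fun n _ => ?_, ?_⟩
  · rw [err, abs_mul, abs_sub_comm φ]
  · have h0 : Tendsto (fun n => - ε (n + 1)) atTop (nhds 0) := by
      simpa using ((tendsto_add_atTop_iff_nat 1).2 hε).neg
    refine h0.congr fun n => ?_
    have hne : φ - S (n + 1) ≠ 0 := by
      intro h
      apply hρ0 (n + 1) (by omega)
      rw [hρ, h, mul_zero]
    rw [eq_div_iff hne]
    linear_combination err n
end

section
/- π = 3 + 4 ∑_{p=1}^{∞} (-1)^{p-1} / ((2p+1)³ - (2p+1)); that is, the series with p-th term (-1)^{p-1}/((2p+1)³-(2p+1)) converges and its sum equals (π - 3)/4. -/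
open Filter

lemma madhava_partial (n : ℕ) :
    ∑ p ∈ Finset.Icc 1 n,
        (-1 : ℝ) ^ (p - 1) / ((2 * (p : ℝ) + 1) ^ 3 - (2 * (p : ℝ) + 1))
      = (∑ i ∈ Finset.range (n + 1), (-1 : ℝ) ^ i / (2 * i + 1)) - 3 / 4
        - (-1 : ℝ) ^ n * (1 / ((n : ℝ) + 1)) / 4 := by
  induction n with
  | zero => norm_num
  | succ k ih =>
    rw [Finset.sum_Icc_succ_top (by omega), ih, Finset.sum_range_succ _ (k + 1)]
    have h1 : (k : ℝ) + 1 ≠ 0 := by positivity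
    have h2 : (k : ℝ) + 1 + 1 ≠ 0 := by positivity
    have h3 : 2 * ((k : ℝ) + 1) + 1 ≠ 0 := by positivity
    have h4 : (2 * ((k : ℝ) + 1) + 1) ^ 3 - (2 * ((k : ℝ) + 1) + 1)
        = 4 * ((k : ℝ) + 1) * ((k : ℝ) + 1 + 1) * (2 * ((k : ℝ) + 1) + 1) := by ring
    push_cast
    rw [h4, pow_succ]
    generalize (∑ i ∈ Finset.range (k + 1), (-1 : ℝ) ^ i / (2 * i + 1)) = S
    field_simp
    ring

/-- First accelerated Mādhava series:
`π = 3 + 4 ∑_{p=1}^∞ (-1)^(p-1) / ((2p+1)³ - (2p+1))`, i.e. the partial sums of the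
series converge and its sum is `(π - 3)/4`. -/
theorem madhava_accelerated_series_one :
    Tendsto
      (fun n : ℕ => ∑ p ∈ Finset.Icc 1 n,
        (-1 : ℝ) ^ (p - 1) / ((2 * (p : ℝ) + 1) ^ 3 - (2 * (p : ℝ) + 1)))
      atTop (nhds ((Real.pi - 3) / 4)) := by
  simp_rw [madhava_partial]
  have hL := Real.tendsto_sum_pi_div_four.comp (tendsto_add_atTop_nat 1)
  have h0 : Tendsto (fun n : ℕ => (-1 : ℝ) ^ n * (1 / ((n : ℝ) + 1))) atTop (nhds 0) := by
    apply squeeze_zero_norm _ (tendsto_one_div_add_atTop_nhds_zero_nat (𝕜 := ℝ))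
    intro n
    rw [norm_mul, norm_pow, norm_neg, norm_one, one_pow, one_mul, Real.norm_of_nonneg]
    positivity
  have h := (hL.sub_const (3 / 4)).sub (h0.div_const 4)
  have e : Real.pi / 4 - 3 / 4 - 0 / 4 = (Real.pi - 3) / 4 := by ring
  rw [e] at h
  exact h
end

section
/- π = 28/9 + 36 ∑_{p=1}^{∞} (-1)^{p-1} / (p(p+1)(2p+1)(4p²+5)(4p²+8p+9)); that is, the series with p-th term (-1)^{p-1}/(p(p+1)(2p+1)(4p²+5)(4p²+8p+9)) converges and its sum equals (π - 28/9)/36. -/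
open Filter

theorem madhava_aux (n : ℕ) :
    ∑ p ∈ Finset.Icc 1 n,
        (-1 : ℝ) ^ (p - 1) /
          ((p : ℝ) * ((p : ℝ) + 1) * (2 * (p : ℝ) + 1) * (4 * (p : ℝ) ^ 2 + 5) *
            (4 * (p : ℝ) ^ 2 + 8 * (p : ℝ) + 9)) =
    ((∑ i ∈ Finset.range (n + 1), (-1 : ℝ) ^ i / (2 * i + 1)) +
      (-1 : ℝ) ^ (n + 1) * ((((n : ℝ) + 1) ^ 2 + 1) / ((4 * ((n : ℝ) + 1) ^ 2 + 5) * ((n : ℝ) + 1)))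
      - 7 / 9) / 9 := by
  induction n with
  | zero => norm_num
  | succ k ih =>
    rw [Finset.sum_Icc_succ_top (by omega), ih, Finset.sum_range_succ _ (k + 1)]
    generalize ∑ i ∈ Finset.range (k + 1), (-1 : ℝ) ^ i / (2 * i + 1) = S
    simp only [Nat.add_sub_cancel, pow_succ (-1 : ℝ)]
    generalize (-1 : ℝ) ^ k = e
    push_cast
    have hk : (0 : ℝ) ≤ k := Nat.cast_nonneg k
    generalize (k : ℝ) = x at hk
    have h1 : x + 1 ≠ 0 := by positivity
    have h2 : x + 1 + 1 ≠ 0 := by positivity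
    have h3 : 2 * (x + 1) + 1 ≠ 0 := by positivity
    have h4 : 4 * (x + 1) ^ 2 + 5 ≠ 0 := by positivity
    have h5 : 4 * (x + 1 + 1) ^ 2 + 5 ≠ 0 := by positivity
    have h6 : 4 * (x + 1) ^ 2 + 8 * (x + 1) + 9 = 4 * (x + 1 + 1) ^ 2 + 5 := by ring
    rw [h6]
    field_simp
    ring

/-- Third accelerated series:
`π = 28/9 + 36 ∑_{p=1}^∞ (-1)^(p-1) / (p(p+1)(2p+1)(4p²+5)(4p²+8p+9))`, i.e. the
partial sums of the series converge and its sum is `(π - 28/9)/36`. -/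
theorem madhava_accelerated_series_three :
    Tendsto
      (fun n : ℕ => ∑ p ∈ Finset.Icc 1 n,
        (-1 : ℝ) ^ (p - 1) /
          ((p : ℝ) * ((p : ℝ) + 1) * (2 * (p : ℝ) + 1) * (4 * (p : ℝ) ^ 2 + 5) *
            (4 * (p : ℝ) ^ 2 + 8 * (p : ℝ) + 9)))
      atTop (nhds ((Real.pi - 28 / 9) / 36)) := by
  simp only [madhava_aux]
  have h1 := (tendsto_add_atTop_iff_nat 1).2 Real.tendsto_sum_pi_div_four
  have h2 : Tendsto (fun n : ℕ => (-1 : ℝ) ^ (n + 1) *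
      ((((n : ℝ) + 1) ^ 2 + 1) / ((4 * ((n : ℝ) + 1) ^ 2 + 5) * ((n : ℝ) + 1))))
      atTop (nhds 0) := by
    refine squeeze_zero_norm (fun n => ?_) (tendsto_one_div_add_atTop_nhds_zero_nat (𝕜 := ℝ))
    rw [norm_mul, norm_pow, norm_neg, norm_one, one_pow, one_mul, Real.norm_of_nonneg (by positivity),
      div_le_div_iff₀ (by positivity) (by positivity)]
    have : (0 : ℝ) < (n : ℝ) + 1 := by positivity
    nlinarith [pow_pos this 3]
  have h3 := ((h1.add h2).sub_const (7 / 9)).div_const 9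
  convert h3 using 2
  ring
end

section
/- Let S_n = ∑_{p=1}^{n} (-1)^{p-1}/(2p-1) be the partial sums of the Mādhava–Leibniz series. Then for every n ≥ 3, the Aitken delta-squared transform satisfies (S_n S_{n-2} - S_{n-1}²) / ((S_n - S_{n-1}) - (S_{n-1} - S_{n-2})) = S_n + (-1)^n (2n-3)/(4(n-1)(2n-1)); in particular the Aitken transform of the Mādhava–Leibniz partial sums coincides with the correction of S_n by the term R_n = (2n-3)/(4(n-1)(2n-1)). -/
/-- For the partial sums `S_n` of the Mādhava–Leibniz series, the Aitken
delta-squared transform equals the correction of `S_n` by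
`R_n = (2n-3)/(4(n-1)(2n-1))`: for all `n ≥ 3`,
`(S_n S_{n-2} - S_{n-1}²)/((S_n - S_{n-1}) - (S_{n-1} - S_{n-2}))
  = S_n + (-1)^n (2n-3)/(4(n-1)(2n-1))`. -/
theorem aitken_of_madhava_leibniz
    (S : ℕ → ℝ) (hS : ∀ n, S n = ∑ p ∈ Finset.Icc 1 n, (-1 : ℝ) ^ (p - 1) / (2 * (p : ℝ) - 1)) :
    ∀ n : ℕ, 3 ≤ n →
      (S n * S (n - 2) - (S (n - 1)) ^ 2) /
          ((S n - S (n - 1)) - (S (n - 1) - S (n - 2)))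
        = S n + (-1 : ℝ) ^ n *
            ((2 * (n : ℝ) - 3) / (4 * ((n : ℝ) - 1) * (2 * (n : ℝ) - 1))) := by
  intro n hn
  obtain ⟨m, rfl⟩ : ∃ m, n = m + 2 := ⟨n - 2, by omega⟩
  have step : ∀ k, S (k + 1) = S k + (-1 : ℝ) ^ k / (2 * (k : ℝ) + 1) := by
    intro k
    rw [hS (k + 1), hS k, Finset.sum_Icc_succ_top (by omega)]
    simp only [Nat.add_sub_cancel]
    push_cast
    ring_nf
  have h1 := step m
  have h2 := step (m + 1)
  have e1 : m + 2 - 2 = m := by omega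
  have e2 : m + 2 - 1 = m + 1 := by omega
  rw [e1, e2, show m + 2 = m + 1 + 1 from rfl, h2, h1]
  have hm : (0 : ℝ) ≤ m := Nat.cast_nonneg m
  generalize S m = T
  push_cast
  have p1 : (2 * (m : ℝ) + 1) ≠ 0 := by positivity
  have p2 : (2 * (m : ℝ) + 3) ≠ 0 := by positivity
  have p3 : ((m : ℝ) + 1) ≠ 0 := by positivity
  have q1 : 2 * ((m : ℝ) + 1) + 1 = 2 * m + 3 := by ring
  have q2 : 2 * ((m : ℝ) + 1 + 1) - 3 = 2 * m + 1 := by ring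
  have q3 : (m : ℝ) + 1 + 1 - 1 = m + 1 := by ring
  have q4 : 2 * ((m : ℝ) + 1 + 1) - 1 = 2 * m + 3 := by ring
  rw [q1, q2, q3, q4, pow_succ (-1 : ℝ) (m + 1), pow_succ (-1 : ℝ) m]
  generalize (m : ℝ) = x at *
  rcases neg_one_pow_eq_or ℝ m with h | h <;> rw [h]
  · have d : (T + 1 / (2 * x + 1) + 1 * -1 / (2 * x + 3) - (T + 1 / (2 * x + 1))
        - (T + 1 / (2 * x + 1) - T)) = -(4 * (x + 1)) / ((2 * x + 1) * (2 * x + 3)) := by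
      field_simp
      ring
    rw [d]
    field_simp
    ring
  · have d : (T + -1 / (2 * x + 1) + -1 * -1 / (2 * x + 3) - (T + -1 / (2 * x + 1))
        - (T + -1 / (2 * x + 1) - T)) = (4 * (x + 1)) / ((2 * x + 1) * (2 * x + 3)) := by
      field_simp
      ring
    rw [d]
    field_simp
    ring
end

section
/- For every integer n ≥ 1, the remainder ρ_n of the Mādhava–Leibniz series satisfies the strict inequalities n/(4n²+1) < ρ_n < (n²+1)/(n(4n²+5)) < 1/(4n); i.e. the second convergent R_n^{(2)} = n/(4n²+1) underestimates ρ_n while the third convergent R_n^{(3)} = (n²+1)/((4n²+5)n) and the first convergent R_n^{(1)} = 1/(4n) overestimate it. -/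
open Filter Topology

lemma aux_pos (e : ℕ → ℝ) (h0 : Tendsto e atTop (𝓝 0))
    (hd : ∀ n, 1 ≤ n → e (n + 2) < e n) (n : ℕ) (hn : 1 ≤ n) : 0 < e n := by
  have hanti : Antitone (fun k : ℕ => e (n + 2 * k)) :=
    antitone_nat_of_succ_le (fun k => (hd (n + 2 * k) (by omega)).le)
  have ht : Tendsto (fun k : ℕ => e (n + 2 * k)) atTop (𝓝 0) :=
    h0.comp (tendsto_atTop_mono (fun k => by simp only [id]; omega) tendsto_id)
  have h1 : 0 ≤ e (n + 2 * 1) := hanti.le_of_tendsto ht 1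
  exact lt_of_le_of_lt h1 (hd n hn)

lemma aux_sq (R : ℕ → ℝ) (h0 : ∀ n, 1 ≤ n → 0 ≤ R n) (h1 : ∀ n, 1 ≤ n → R n ≤ 1 / (n : ℝ)) :
    Tendsto R atTop (𝓝 0) := by
  refine tendsto_of_tendsto_of_tendsto_of_le_of_le' tendsto_const_nhds
    (tendsto_one_div_atTop_nhds_zero_nat (𝕜 := ℝ)) ?_ ?_
  · filter_upwards [eventually_ge_atTop 1] with n hn using h0 n hn
  · filter_upwards [eventually_ge_atTop 1] with n hn using h1 n hn

lemma aux_d2 (x : ℝ) (hx : 1 ≤ x) :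
    1 / (2 * x + 1) - x / (4 * x ^ 2 + 1) - (x + 1) / (4 * (x + 1) ^ 2 + 1)
      = 4 / ((2 * x + 1) * (4 * x ^ 2 + 1) * (4 * (x + 1) ^ 2 + 1)) := by
  have : 2 * x + 1 ≠ 0 := by positivity
  have : 4 * x ^ 2 + 1 ≠ 0 := by positivity
  have : 4 * (x + 1) ^ 2 + 1 ≠ 0 := by positivity
  field_simp
  ring

lemma aux_d3 (x : ℝ) (hx : 1 ≤ x) :
    (x ^ 2 + 1) / (x * (4 * x ^ 2 + 5))
      + ((x + 1) ^ 2 + 1) / ((x + 1) * (4 * (x + 1) ^ 2 + 5)) - 1 / (2 * x + 1)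
      = 9 / ((2 * x + 1) * x * (x + 1) * (4 * x ^ 2 + 5) * (4 * (x + 1) ^ 2 + 5)) := by
  have : x ≠ 0 := by positivity
  have : x + 1 ≠ 0 := by positivity
  have : 2 * x + 1 ≠ 0 := by positivity
  have : 4 * x ^ 2 + 5 ≠ 0 := by positivity
  have : 4 * (x + 1) ^ 2 + 5 ≠ 0 := by positivity
  field_simp
  ring

lemma aux_m2 (x : ℝ) (hx : 1 ≤ x) :
    4 / ((2 * (x + 1) + 1) * (4 * (x + 1) ^ 2 + 1) * (4 * (x + 1 + 1) ^ 2 + 1))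
      < 4 / ((2 * x + 1) * (4 * x ^ 2 + 1) * (4 * (x + 1) ^ 2 + 1)) := by
  have : x < x + 1 := by linarith
  gcongr

lemma aux_m3 (x : ℝ) (hx : 1 ≤ x) :
    9 / ((2 * (x + 1) + 1) * (x + 1) * (x + 1 + 1) * (4 * (x + 1) ^ 2 + 5)
        * (4 * (x + 1 + 1) ^ 2 + 5))
      < 9 / ((2 * x + 1) * x * (x + 1) * (4 * x ^ 2 + 5) * (4 * (x + 1) ^ 2 + 5)) := by
  have : x < x + 1 := by linarith
  gcongr

/-- For every `n ≥ 1`, the remainder `ρ_n = (-1)^n (π/4 - S_n)` of the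
Mādhava–Leibniz series satisfies
`n/(4n²+1) < ρ_n < (n²+1)/(n(4n²+5)) < 1/(4n)`. -/
theorem madhava_leibniz_remainder_bounds
    (S : ℕ → ℝ) (hS : ∀ n, S n = ∑ p ∈ Finset.Icc 1 n, (-1 : ℝ) ^ (p - 1) / (2 * (p : ℝ) - 1))
    (ρ : ℕ → ℝ) (hρ : ∀ n, ρ n = (-1 : ℝ) ^ n * (Real.pi / 4 - S n)) :
    ∀ n : ℕ, 1 ≤ n →
      (n : ℝ) / (4 * (n : ℝ) ^ 2 + 1) < ρ n ∧
      ρ n < ((n : ℝ) ^ 2 + 1) / ((n : ℝ) * (4 * (n : ℝ) ^ 2 + 5)) ∧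
      ((n : ℝ) ^ 2 + 1) / ((n : ℝ) * (4 * (n : ℝ) ^ 2 + 5)) < 1 / (4 * (n : ℝ)) := by
  have hsucc : ∀ n, S (n + 1) = S n + (-1 : ℝ) ^ n / (2 * (n : ℝ) + 1) := by
    intro n
    rw [hS, hS, Finset.sum_Icc_succ_top (by omega)]
    congr 2
    push_cast
    ring
  have hSr : ∀ n, S n = ∑ i ∈ Finset.range n, (-1 : ℝ) ^ i / (2 * (i : ℝ) + 1) := by
    intro n
    induction n with
    | zero => simp [hS]
    | succ k ih => rw [hsucc, ih, Finset.sum_range_succ]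
  have hSt : Tendsto S atTop (𝓝 (Real.pi / 4)) :=
    Real.tendsto_sum_pi_div_four.congr (fun n => (hSr n).symm)
  have hρt : Tendsto ρ atTop (𝓝 0) := by
    rw [tendsto_zero_iff_abs_tendsto_zero]
    have h := ((tendsto_const_nhds (x := Real.pi / 4)).sub hSt).abs
    rw [sub_self, abs_zero] at h
    refine h.congr (fun n => ?_)
    simp [hρ, abs_mul]
  have hrec : ∀ n : ℕ, ρ n + ρ (n + 1) = 1 / (2 * (n : ℝ) + 1) := by
    intro n
    rw [hρ, hρ, hsucc, pow_succ]
    have h1 : (-1 : ℝ) ^ n * (-1 : ℝ) ^ n = 1 := by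
      rw [← mul_pow]; norm_num
    linear_combination (1 / (2 * (n : ℝ) + 1)) * h1
  intro n hn
  refine ⟨?_, ?_, ?_⟩
  · have hR : Tendsto (fun n : ℕ => (n : ℝ) / (4 * (n : ℝ) ^ 2 + 1)) atTop (𝓝 0) := by
      refine aux_sq _ (fun n _ => by positivity) (fun n hn => ?_)
      have : (1 : ℝ) ≤ n := by exact_mod_cast hn
      rw [div_le_div_iff₀ (by positivity) (by positivity)]
      nlinarith
    have h := aux_pos (fun n : ℕ => ρ n - (n : ℝ) / (4 * (n : ℝ) ^ 2 + 1))
      (by simpa using hρt.sub hR) (fun n hn => ?_) n hn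
    · simpa using h
    · have hx : (1 : ℝ) ≤ n := by exact_mod_cast hn
      have a := hrec n
      have b := hrec (n + 1)
      have c := aux_d2 n hx
      have d := aux_d2 (n + 1) (by linarith)
      have m := aux_m2 n hx
      have e : ((n + 2 : ℕ) : ℝ) = (n : ℝ) + 1 + 1 := by push_cast; ring
      simp only [e]
      push_cast at b
      rw [show n + 1 + 1 = n + 2 from rfl] at b
      linarith
  · have hR : Tendsto (fun n : ℕ => ((n : ℝ) ^ 2 + 1) / ((n : ℝ) * (4 * (n : ℝ) ^ 2 + 5)))
        atTop (𝓝 0) := by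
      refine aux_sq _ (fun n _ => by positivity) (fun n hn => ?_)
      have : (1 : ℝ) ≤ n := by exact_mod_cast hn
      rw [div_le_div_iff₀ (by positivity) (by positivity)]
      nlinarith [pow_pos (zero_lt_one.trans_le this) 3]
    have h := aux_pos
      (fun n : ℕ => ((n : ℝ) ^ 2 + 1) / ((n : ℝ) * (4 * (n : ℝ) ^ 2 + 5)) - ρ n)
      (by simpa using hR.sub hρt) (fun n hn => ?_) n hn
    · exact sub_pos.mp h
    · have hx : (1 : ℝ) ≤ n := by exact_mod_cast hn
      have a := hrec n
      have b := hrec (n + 1)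
      have c := aux_d3 n hx
      have d := aux_d3 (n + 1) (by linarith)
      have m := aux_m3 n hx
      have e : ((n + 2 : ℕ) : ℝ) = (n : ℝ) + 1 + 1 := by push_cast; ring
      simp only [e]
      push_cast at b
      rw [show n + 1 + 1 = n + 2 from rfl] at b
      linarith
  · have : (1 : ℝ) ≤ n := by exact_mod_cast hn
    rw [div_lt_div_iff₀ (by positivity) (by positivity)]
    nlinarith
end

section
/- The remainders of the Mādhava–Leibniz series satisfy ρ_n ∼ 1/(4n): the sequence (4n·ρ_n)_{n≥1} converges to 1. -/
open Filter

lemma ml_intble (n : ℕ) :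
    IntervalIntegrable (fun x : ℝ => x ^ (2 * n) / (1 + x ^ 2)) MeasureTheory.volume 0 1 := by
  apply Continuous.intervalIntegrable
  apply Continuous.div (by fun_prop) (by fun_prop)
  intro x
  positivity

lemma ml_sum (n : ℕ) :
    (∫ x in (0 : ℝ)..1, x ^ (2 * (n + 1)) / (1 + x ^ 2)) + ∫ x in (0 : ℝ)..1, x ^ (2 * n) / (1 + x ^ 2)
      = 1 / (2 * (n : ℝ) + 1) := by
  rw [← intervalIntegral.integral_add (ml_intble _) (ml_intble _)]
  have h : ∀ x : ℝ, x ^ (2 * (n + 1)) / (1 + x ^ 2) + x ^ (2 * n) / (1 + x ^ 2) = x ^ (2 * n) := by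
    intro x
    have : 1 + x ^ 2 ≠ 0 := by positivity
    field_simp
    ring
  simp only [h, integral_pow]
  simp

lemma ml_anti (n : ℕ) :
    (∫ x in (0 : ℝ)..1, x ^ (2 * (n + 1)) / (1 + x ^ 2)) ≤ ∫ x in (0 : ℝ)..1, x ^ (2 * n) / (1 + x ^ 2) := by
  apply intervalIntegral.integral_mono_on zero_le_one (ml_intble _) (ml_intble _)
  intro x hx
  have : x ^ (2 * (n + 1)) ≤ x ^ (2 * n) := pow_le_pow_of_le_one hx.1 hx.2 (by omega)
  gcongr

/-- The remainders `ρ_n = (-1)^n (π/4 - S_n)` of the Mādhava–Leibniz series satisfy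
`ρ_n ∼ 1/(4n)`: the sequence `4n·ρ_n` converges to `1`. -/
theorem madhava_leibniz_remainder_equivalent
    (S : ℕ → ℝ) (hS : ∀ n, S n = ∑ p ∈ Finset.Icc 1 n, (-1 : ℝ) ^ (p - 1) / (2 * (p : ℝ) - 1))
    (ρ : ℕ → ℝ) (hρ : ∀ n, ρ n = (-1 : ℝ) ^ n * (Real.pi / 4 - S n)) :
    Tendsto (fun n : ℕ => 4 * (n : ℝ) * ρ n) atTop (nhds 1) := by
  have hrec : ∀ n : ℕ, ρ (n + 1) + ρ n = 1 / (2 * n + 1) := by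
    intro n
    have h1 : S (n + 1) = S n + (-1 : ℝ) ^ n / (2 * n + 1) := by
      rw [hS, hS, Finset.sum_Icc_succ_top (by omega)]
      push_cast
      try simp only [Nat.add_sub_cancel]
      congr 2
      ring
    have h2 : ((-1 : ℝ) ^ n) * (-1) ^ n = 1 := by
      rw [← mul_pow]; simp
    rw [hρ, hρ, h1, pow_succ]
    linear_combination (1 / (2 * (n : ℝ) + 1)) * h2
  have hint : ∀ n, ρ n = ∫ x in (0 : ℝ)..1, x ^ (2 * n) / (1 + x ^ 2) := by
    intro n
    induction n with
    | zero => simp [hρ, hS]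
    | succ k ih =>
      have := hrec k
      have := ml_sum k
      linarith
  have hanti : ∀ n, ρ (n + 1) ≤ ρ n := by
    intro n
    rw [hint, hint]
    exact ml_anti n
  rw [← tendsto_add_atTop_iff_nat 1]
  have hinv : Tendsto (fun n : ℕ => 1 / ((n : ℝ) + 1)) atTop (nhds 0) :=
    tendsto_one_div_add_atTop_nhds_zero_nat
  have hlo : Tendsto (fun n : ℕ => 1 - 1 / ((n : ℝ) + 1)) atTop (nhds 1) := by
    simpa using hinv.const_sub 1
  have hhi : Tendsto (fun n : ℕ => 1 + 1 / ((n : ℝ) + 1)) atTop (nhds 1) := by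
    simpa using hinv.const_add 1
  refine tendsto_of_tendsto_of_tendsto_of_le_of_le hlo hhi ?_ ?_
  · intro n
    have a := hrec (n + 1)
    have b := hanti (n + 1)
    push_cast at a ⊢
    have c : 1 / (2 * ((n : ℝ) + 1) + 1) / 2 ≤ ρ (n + 1) := by linarith
    calc 1 - 1 / ((n : ℝ) + 1) ≤ 4 * ((n : ℝ) + 1) * (1 / (2 * ((n : ℝ) + 1) + 1) / 2) := by
          rw [← sub_nonneg]
          have : 4 * ((n : ℝ) + 1) * (1 / (2 * ((n : ℝ) + 1) + 1) / 2) - (1 - 1 / ((n : ℝ) + 1))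
            = (n + 2) / ((n + 1) * (2 * ((n : ℝ) + 1) + 1)) := by
            field_simp
            ring
          rw [this]
          positivity
      _ ≤ _ := by gcongr
  · intro n
    have a := hrec n
    have b := hanti n
    push_cast
    have c : ρ (n + 1) ≤ 1 / (2 * (n : ℝ) + 1) / 2 := by linarith
    calc 4 * ((n : ℝ) + 1) * ρ (n + 1) ≤ 4 * ((n : ℝ) + 1) * (1 / (2 * (n : ℝ) + 1) / 2) := by gcongr
      _ ≤ 1 + 1 / ((n : ℝ) + 1) := by
          rw [← sub_nonneg]
          have : 1 + 1 / ((n : ℝ) + 1) - 4 * ((n : ℝ) + 1) * (1 / (2 * (n : ℝ) + 1) / 2)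
            = n / ((n + 1) * (2 * (n : ℝ) + 1)) := by
            field_simp
            ring
          rw [this]
          positivity
end

section
/- Let a_n = 3 + 4 ∑_{p=1}^{n} (-1)^{p-1}/((2p+1)³-(2p+1)) and b_n = 16 ∑_{p=0}^{n} (-1)^p/((2p+1)⁵+4(2p+1)). Then for every n ≥ 1, |π - a_n| ≤ 4/((2n+3)³-(2n+3)) and |π - b_n| ≤ 16/((2n+3)⁵+4(2n+3)). -/
open Filter Topology in
lemma alt_bound (s d : ℕ → ℝ) (L : ℝ) (hs : Tendsto s atTop (𝓝 L))
    (h0 : ∀ k, 0 ≤ d k) (hd : ∀ k, d (k + 1) ≤ d k)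
    (hstep : ∀ k, s (k + 1) = s k + (-1) ^ k * d k) (n : ℕ) : |L - s n| ≤ d n := by
  have key : ∀ j k : ℕ, 0 ≤ (-1 : ℝ) ^ k * (s (k + j) - s k) ∧
      (-1 : ℝ) ^ k * (s (k + j) - s k) ≤ d k := by
    intro j
    induction j with
    | zero => intro k; simp [h0 k]
    | succ j ih =>
      intro k
      obtain ⟨h1, h2⟩ := ih (k + 1)
      have e : (-1 : ℝ) ^ k * (s (k + (j + 1)) - s k) =
          d k - (-1 : ℝ) ^ (k + 1) * (s (k + 1 + j) - s (k + 1)) := by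
        have hsq : (-1 : ℝ) ^ k * (-1 : ℝ) ^ k = 1 := by
          rw [← mul_pow]; norm_num
        have : k + (j + 1) = k + 1 + j := by ring
        rw [this, hstep k, pow_succ]
        linear_combination (d k) * hsq
      rw [e]
      constructor <;> linarith [hd k]
  have hb : ∀ j, |s (j + n) - s n| ≤ d n := by
    intro j
    obtain ⟨h1, h2⟩ := key j n
    rw [add_comm j n]
    have : |(-1 : ℝ) ^ n * (s (n + j) - s n)| ≤ d n := by rw [abs_of_nonneg h1]; exact h2
    simpa [abs_mul] using this
  have ht : Tendsto (fun j => |s (j + n) - s n|) atTop (𝓝 |L - s n|) :=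
    (((tendsto_add_atTop_iff_nat n).2 hs).sub_const _).abs
  exact le_of_tendsto' ht hb

open Filter Topology in
lemma corr_tendsto (s c : ℕ → ℝ) (hc0 : ∀ k, |c k| ≤ 1 / ((k : ℝ) + 1))
    (hs : ∀ k, s k = 4 * ∑ i ∈ Finset.range (k + 1), (-1 : ℝ) ^ i / (2 * (i : ℝ) + 1) + c k) :
    Tendsto s atTop (𝓝 Real.pi) := by
  have h1 := ((tendsto_add_atTop_iff_nat 1).2 Real.tendsto_sum_pi_div_four).const_mul 4
  have h2 : Tendsto c atTop (𝓝 0) :=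
    squeeze_zero_norm hc0 tendsto_one_div_add_atTop_nhds_zero_nat
  have h3 := h1.add h2
  rw [show (4 : ℝ) * (Real.pi / 4) + 0 = Real.pi by ring] at h3
  exact h3.congr fun k => (hs k).symm

/-- Error bounds for the two accelerated Mādhava series: with
`a_n = 3 + 4 ∑_{p=1}^n (-1)^(p-1)/((2p+1)³-(2p+1))` and
`b_n = 16 ∑_{p=0}^n (-1)^p/((2p+1)⁵+4(2p+1))`, for every `n ≥ 1` one has
`|π - a_n| ≤ 4/((2n+3)³-(2n+3))` and `|π - b_n| ≤ 16/((2n+3)⁵+4(2n+3))`. -/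
theorem madhava_accelerated_series_error_bounds
    (a b : ℕ → ℝ)
    (ha : ∀ n, a n = 3 + 4 * ∑ p ∈ Finset.Icc 1 n,
      (-1 : ℝ) ^ (p - 1) / ((2 * (p : ℝ) + 1) ^ 3 - (2 * (p : ℝ) + 1)))
    (hb : ∀ n, b n = 16 * ∑ p ∈ Finset.range (n + 1),
      (-1 : ℝ) ^ p / ((2 * (p : ℝ) + 1) ^ 5 + 4 * (2 * (p : ℝ) + 1))) :
    ∀ n : ℕ, 1 ≤ n →
      |Real.pi - a n| ≤ 4 / ((2 * (n : ℝ) + 3) ^ 3 - (2 * (n : ℝ) + 3)) ∧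
      |Real.pi - b n| ≤ 16 / ((2 * (n : ℝ) + 3) ^ 5 + 4 * (2 * (n : ℝ) + 3)) := by
  have apos : ∀ k : ℕ, 0 < (2 * (k : ℝ) + 3) ^ 3 - (2 * (k : ℝ) + 3) := by
    intro k
    have : (2 * (k : ℝ) + 3) ^ 3 - (2 * (k : ℝ) + 3)
      = (2 * (k : ℝ) + 3) * (2 * k + 2) * (2 * k + 4) := by ring
    rw [this]; positivity
  have astep : ∀ k, a (k + 1) = a k
      + (-1) ^ k * (4 / ((2 * (k : ℝ) + 3) ^ 3 - (2 * (k : ℝ) + 3))) := by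
    intro k
    rw [ha, ha, Finset.sum_Icc_succ_top (by omega)]
    push_cast
    rw [show 2 * ((k : ℝ) + 1) + 1 = 2 * k + 3 by ring]
    ring
  have bstep : ∀ k, b (k + 1) = b k
      + (-1) ^ (k + 1) * (16 / ((2 * (k : ℝ) + 3) ^ 5 + 4 * (2 * (k : ℝ) + 3))) := by
    intro k
    rw [hb, hb, Finset.sum_range_succ _ (k + 1)]
    push_cast
    rw [show 2 * ((k : ℝ) + 1) + 1 = 2 * k + 3 by ring]
    ring
  have alim : Filter.Tendsto a Filter.atTop (nhds Real.pi) := by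
    refine corr_tendsto a (fun k => (-1) ^ (k + 1) * (1 / ((k : ℝ) + 1))) ?_ ?_
    · intro k
      rw [abs_mul, abs_pow, abs_neg, abs_one, one_pow, one_mul, abs_of_nonneg (by positivity)]
    · intro k
      induction k with
      | zero => rw [ha]; norm_num
      | succ k ih =>
        rw [astep, ih, Finset.sum_range_succ _ (k + 1)]
        have e : 4 / ((2 * (k : ℝ) + 3) ^ 3 - (2 * (k : ℝ) + 3))
            = 1 / ((k : ℝ) + 1) + 1 / ((k : ℝ) + 2) - 4 / (2 * (k : ℝ) + 3) := by
          have := (apos k).ne'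
          have h1 : (k : ℝ) + 1 ≠ 0 := by positivity
          have h2 : (k : ℝ) + 2 ≠ 0 := by positivity
          have h3 : 2 * (k : ℝ) + 3 ≠ 0 := by positivity
          rw [div_add_div _ _ h1 h2, div_sub_div _ _ (by positivity) h3,
            div_eq_div_iff this (by positivity)]
          ring
        rw [e]
        push_cast
        rw [show 2 * ((k : ℝ) + 1) + 1 = 2 * k + 3 by ring,
          show (k : ℝ) + 1 + 1 = k + 2 by ring]
        ring
  have blim : Filter.Tendsto b Filter.atTop (nhds Real.pi) := by
    refine corr_tendsto b
      (fun k => (-1) ^ (k + 1) * (4 * ((k : ℝ) + 1) / (4 * ((k : ℝ) + 1) ^ 2 + 1))) ?_ ?_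
    · intro k
      rw [abs_mul, abs_pow, abs_neg, abs_one, one_pow, one_mul, abs_of_nonneg (by positivity),
        div_le_div_iff₀ (by positivity) (by positivity)]
      nlinarith
    · intro k
      induction k with
      | zero => rw [hb]; norm_num
      | succ k ih =>
        rw [bstep, ih, Finset.sum_range_succ _ (k + 1)]
        have e : 16 / ((2 * (k : ℝ) + 3) ^ 5 + 4 * (2 * (k : ℝ) + 3))
            = 4 / (2 * (k : ℝ) + 3) - (4 * ((k : ℝ) + 1) / (4 * ((k : ℝ) + 1) ^ 2 + 1)
              + 4 * ((k : ℝ) + 2) / (4 * ((k : ℝ) + 2) ^ 2 + 1)) := by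
          have h1 : 4 * ((k : ℝ) + 1) ^ 2 + 1 ≠ 0 := by positivity
          have h2 : 4 * ((k : ℝ) + 2) ^ 2 + 1 ≠ 0 := by positivity
          have h3 : 2 * (k : ℝ) + 3 ≠ 0 := by positivity
          rw [div_add_div _ _ h1 h2, div_sub_div _ _ h3 (by positivity),
            div_eq_div_iff (by positivity) (by positivity)]
          ring
        rw [e]
        push_cast
        rw [show 2 * ((k : ℝ) + 1) + 1 = 2 * k + 3 by ring,
          show (k : ℝ) + 1 + 1 = k + 2 by ring]
        ring
  intro n _
  constructor
  · refine alt_bound a (fun k => 4 / ((2 * (k : ℝ) + 3) ^ 3 - (2 * (k : ℝ) + 3))) _ alim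
      (fun k => (div_pos (by norm_num) (apos k)).le) (fun k => ?_) astep n
    refine div_le_div_of_nonneg_left (by norm_num) (apos k) ?_
    have : (0 : ℝ) ≤ k := by positivity
    push_cast
    nlinarith
  · have h := alt_bound (fun k => - b k)
      (fun k => 16 / ((2 * (k : ℝ) + 3) ^ 5 + 4 * (2 * (k : ℝ) + 3))) _ blim.neg
      (fun k => by positivity) (fun k => ?_) (fun k => ?_) n
    · rw [abs_sub_comm] at h
      rw [show Real.pi - b n = -b n - -Real.pi by ring]
      exact h
    · refine div_le_div_of_nonneg_left (by norm_num) (by positivity) ?_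
      have : (k : ℝ) ≤ ((k + 1 : ℕ) : ℝ) := by push_cast; linarith
      gcongr
    · simp only [bstep k]
      ring
end
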